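/- Coercivity and lower bound of I in the case 0 < k₁₂ < 1: assume p > q > 0 (so 0 < k₁₂ < 1), α > 0 and β > (α k₁₂²)/|K|. Then there exist constants δ > 0 and C ∈ ℝ such that for every (ξ,ζ) ∈ 𝒜, writing ξ = ξ̄ + ξ′ and ζ = ζ̄ + ζ′ with ξ̄, ζ̄ ∈ ℝ and ξ′, ζ′ ∈ 𝓗̃, one has I(ξ,ζ) ≥ δ ( ‖∇ξ′‖²_{L²(dx)} + (|K|/k₁₂²) ‖∇ζ′‖²_{L²(dx)} ) + C. In particular I is bounded below and coercive on 𝒜. -/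

import Mathlib

noncomputable section

open MeasureTheory Real Filter Topology
open scoped ENNReal

abbrev Plane : Type := EuclideanSpace ℝ (Fin 2)

/-- The weighted measure dμ = h₀ dx on the plane. -/
def wMeasure (h₀ : Plane → ℝ) : Measure Plane :=
  volume.withDensity fun x => ENNReal.ofReal (h₀ x)

/-- Membership in the weighted Sobolev space 𝓗 : the (distributional) gradient is
square integrable with respect to Lebesgue measure and the function itself is square
integrable with respect to the weighted measure dμ. -/
def MemH (h₀ : Plane → ℝ) (u : Plane → ℝ) : Prop :=
  Differentiable ℝ u ∧
    Integrable (fun x => ‖gradient u x‖ ^ 2) volume ∧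
    Integrable (fun x => u x ^ 2) (wMeasure h₀)

/-- Membership in 𝓗̃, the subspace of 𝓗 of functions with zero dμ-mean. -/
def MemHt (h₀ : Plane → ℝ) (u : Plane → ℝ) : Prop :=
  MemH h₀ u ∧ ∫ x, u x ∂(wMeasure h₀) = 0

/-- The squared 𝓗-norm: ‖u‖²_𝓗 = ‖∇u‖²_{L²(dx)} + ‖u‖²_{L²(dμ)}. -/
def HnormSq (h₀ : Plane → ℝ) (u : Plane → ℝ) : ℝ :=
  (∫ x, ‖gradient u x‖ ^ 2) + ∫ x, u x ^ 2 ∂(wMeasure h₀)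

/-- The 𝓗-norm. -/
def Hnorm (h₀ : Plane → ℝ) (u : Plane → ℝ) : ℝ :=
  Real.sqrt (HnormSq h₀ u)

/-- The entry k₁₁ = (p+q)/p of the coupling matrix. -/
def k11 (p q : ℝ) : ℝ := (p + q) / p

/-- The entry k₁₂ = (p−q)/p of the coupling matrix. -/
def k12 (p q : ℝ) : ℝ := (p - q) / p

/-- The determinant |K| = 4q/p of the coupling matrix. -/
def Kdet (p q : ℝ) : ℝ := 4 * q / p

/-- The action functional I(ξ,ζ) (with σ = |K|/k₁₂²). -/
def Ifun (p q : ℝ) (f h : Plane → ℝ) (ξ ζ : Plane → ℝ) : ℝ :=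
  ∫ x, ((1 : ℝ) / 2 * ‖gradient ξ x‖ ^ 2
      + Kdet p q / (2 * k12 p q ^ 2) * ‖gradient ζ x‖ ^ 2
      + f x * ξ x + Kdet p q / k12 p q ^ 2 * h x * ζ x)

/-- The admissible set 𝒜 : pairs in 𝓗 × 𝓗 satisfying the two natural constraints. -/
def Admissible (h₀ : Plane → ℝ) (p q α β : ℝ) (U V : Plane → ℝ)
    (ξ ζ : Plane → ℝ) : Prop :=
  MemH h₀ ξ ∧ MemH h₀ ζ ∧
  Integrable (fun x => V x * Real.exp ((ξ x - ζ x) / 2)) volume ∧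
  Integrable (fun x => U x * Real.exp (-(k11 p q / (2 * k12 p q)) * ζ x)) volume ∧
  2 * Kdet p q / k11 p q * (∫ x, V x * Real.exp ((ξ x - ζ x) / 2)) = 2 * π * α ∧
  2 * k12 p q * (∫ x, U x * Real.exp (-(k11 p q / (2 * k12 p q)) * ζ x))
    + 2 * k12 p q ^ 2 / k11 p q * (∫ x, V x * Real.exp ((ξ x - ζ x) / 2)) = 2 * π * β

/-- Along a segment, the increment of a differentiable function is at most the (possibly
infinite) integral of the norm of its derivative times the length of the segment. -/
theorem enorm_sub_le_lintegral_segment {u : Plane → ℝ} (hu : Differentiable ℝ u) (x y : Plane) :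
    ‖u y - u x‖ₑ ≤
      ∫⁻ t in Set.Ioc (0 : ℝ) 1, ‖fderiv ℝ u (x + t • (y - x))‖ₑ * ‖y - x‖ₑ := by
  have hder : ∀ t : ℝ, HasDerivAt (fun t : ℝ => u (x + t • (y - x)))
      (fderiv ℝ u (x + t • (y - x)) (y - x)) t := by
    intro t
    have h1 : HasDerivAt (fun t : ℝ => x + t • (y - x)) (y - x) t := by
      simpa using ((hasDerivAt_id t).smul_const (y - x)).const_add x
    exact (hu _).hasFDerivAt.comp_hasDerivAt t h1
  have hmeas : Measurable fun t : ℝ => fderiv ℝ u (x + t • (y - x)) (y - x) :=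
    (measurable_fderiv_apply_const ℝ u (y - x)).comp (by fun_prop)
  have hle : ∫⁻ t in Set.Ioc (0 : ℝ) 1, ‖fderiv ℝ u (x + t • (y - x)) (y - x)‖ₑ ≤
      ∫⁻ t in Set.Ioc (0 : ℝ) 1, ‖fderiv ℝ u (x + t • (y - x))‖ₑ * ‖y - x‖ₑ :=
    lintegral_mono fun t => ContinuousLinearMap.le_opENorm _ _
  refine le_trans ?_ hle
  by_cases hint : IntegrableOn (fun t : ℝ => fderiv ℝ u (x + t • (y - x)) (y - x))
      (Set.Ioc 0 1) volume
  · have hint' : IntervalIntegrable (fun t : ℝ => fderiv ℝ u (x + t • (y - x)) (y - x))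
        volume 0 1 := (intervalIntegrable_iff_integrableOn_Ioc_of_le zero_le_one).2 hint
    have hftc := intervalIntegral.integral_eq_sub_of_hasDerivAt (fun t _ => hder t) hint'
    simp only [one_smul, zero_smul, add_zero, add_sub_cancel] at hftc
    rw [← hftc, intervalIntegral.integral_of_le zero_le_one]
    exact enorm_integral_le_lintegral_enorm _
  · have htop : ∫⁻ t in Set.Ioc (0 : ℝ) 1, ‖fderiv ℝ u (x + t • (y - x)) (y - x)‖ₑ = ∞ := by
      by_contra hne
      exact hint ⟨hmeas.aestronglyMeasurable, lt_top_iff_ne_top.2 hne⟩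
    rw [htop]
    exact le_top

theorem enorm_mul_enorm_le {E F : Type*} [NormedAddCommGroup E] [NormedAddCommGroup F]
    (a : E) (b : F) {ε : ℝ} (hε : 0 < ε) :
    ‖a‖ₑ * ‖b‖ₑ ≤ ENNReal.ofReal ε * ‖a‖ₑ ^ 2 + ENNReal.ofReal ε⁻¹ * ‖b‖ₑ ^ 2 := by
  simp only [← ofReal_norm]
  rw [← ENNReal.ofReal_mul (norm_nonneg a), ← ENNReal.ofReal_pow (norm_nonneg a),
    ← ENNReal.ofReal_pow (norm_nonneg b), ← ENNReal.ofReal_mul hε.le,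
    ← ENNReal.ofReal_mul (inv_nonneg.2 hε.le),
    ← ENNReal.ofReal_add (by positivity) (by positivity)]
  apply ENNReal.ofReal_le_ofReal
  have hsq : ε * ‖a‖ ^ 2 + ε⁻¹ * ‖b‖ ^ 2 - ‖a‖ * ‖b‖ =
      ε⁻¹ * ((ε * ‖a‖ - ‖b‖ / 2) ^ 2 + 3 / 4 * ‖b‖ ^ 2) := by
    field_simp
    ring
  have : 0 ≤ ε⁻¹ * ((ε * ‖a‖ - ‖b‖ / 2) ^ 2 + 3 / 4 * ‖b‖ ^ 2) := by positivity
  linarith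

theorem enorm_sub_le_lintegral_sq {u : Plane → ℝ} (hu : Differentiable ℝ u) (x y : Plane)
    {ε : ℝ} (hε : 0 < ε) :
    ‖u y - u x‖ₑ ≤
      ENNReal.ofReal ε * (∫⁻ t in Set.Ioc (0 : ℝ) 1, ‖fderiv ℝ u (x + t • (y - x))‖ₑ ^ 2)
        + ENNReal.ofReal ε⁻¹ * ‖y - x‖ₑ ^ 2 := by
  have hm : Measurable fun t : ℝ => ‖fderiv ℝ u (x + t • (y - x))‖ₑ ^ 2 :=
    ((measurable_fderiv ℝ u).comp
      (by fun_prop : Measurable fun t : ℝ => x + t • (y - x))).enorm.pow_const 2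
  calc ‖u y - u x‖ₑ ≤ _ := enorm_sub_le_lintegral_segment hu x y
    _ ≤ ∫⁻ t in Set.Ioc (0 : ℝ) 1, (ENNReal.ofReal ε * ‖fderiv ℝ u (x + t • (y - x))‖ₑ ^ 2
          + ENNReal.ofReal ε⁻¹ * ‖y - x‖ₑ ^ 2) :=
        lintegral_mono fun t => enorm_mul_enorm_le _ _ hε
    _ = _ := by
        rw [lintegral_add_right _ measurable_const, lintegral_const_mul _ hm]
        simp

theorem lintegral_comp_smul_add_le {g : Plane → ℝ≥0∞} (hg : Measurable g) {c : ℝ}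
    (hc : 1 / 2 ≤ c) (b : Plane) :
    ∫⁻ x, g (c • x + b) ≤ 4 * ∫⁻ x, g x := by
  have hc0 : c ≠ 0 := by linarith
  have hscale : ∫⁻ x : Plane, g (c • x + b) =
      ENNReal.ofReal |(c ^ Module.finrank ℝ Plane)⁻¹| * ∫⁻ x, g x := by
    rw [← lintegral_add_right_eq_self g b, ← smul_eq_mul, ← lintegral_smul_measure,
      ← Measure.map_addHaar_smul (volume : Measure Plane) hc0,
      lintegral_map (by fun_prop) (by fun_prop)]
  rw [hscale]
  gcongr
  rw [show (4 : ℝ≥0∞) = ENNReal.ofReal 4 by simp]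
  apply ENNReal.ofReal_le_ofReal
  rw [finrank_euclideanSpace_fin, abs_of_pos (by positivity)]
  apply inv_le_of_inv_le₀ (by norm_num)
  nlinarith

theorem lintegral_lintegral_segment_le {F H g : Plane → ℝ≥0∞} (hF : Measurable F)
    (hH : Measurable H) (hg : Measurable g) {a b : ℝ≥0∞} (hFa : ∀ x, F x ≤ a)
    (hHb : ∀ x, H x ≤ b) (t : ℝ) :
    ∫⁻ x, ∫⁻ y, F x * (H y * g (x + t • (y - x))) ≤
      4 * (a * (∫⁻ y, H y) + b * ∫⁻ x, F x) * ∫⁻ z, g z := by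
  rcases le_total t (1 / 2) with ht | ht
  · calc ∫⁻ x, ∫⁻ y, F x * (H y * g (x + t • (y - x)))
        ≤ ∫⁻ x, ∫⁻ y, a * (H y * g ((1 - t) • x + t • y)) := by
          refine lintegral_mono fun x => lintegral_mono fun y => ?_
          dsimp only
          rw [show x + t • (y - x) = (1 - t) • x + t • y by module]
          gcongr
          exact hFa x
      _ = ∫⁻ y, ∫⁻ x, a * (H y * g ((1 - t) • x + t • y)) :=
          lintegral_lintegral_swap (by fun_prop)
      _ = ∫⁻ y, a * (H y * ∫⁻ x, g ((1 - t) • x + t • y)) := by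
          refine lintegral_congr fun y => ?_
          rw [lintegral_const_mul _ (by fun_prop), lintegral_const_mul _ (by fun_prop)]
      _ ≤ ∫⁻ y, a * (H y * (4 * ∫⁻ z, g z)) := by
          gcongr with y
          exact lintegral_comp_smul_add_le hg (by linarith) _
      _ = 4 * (a * ∫⁻ y, H y) * ∫⁻ z, g z := by
          rw [lintegral_const_mul _ (by fun_prop), lintegral_mul_const _ hH]
          ring
      _ ≤ _ := by
          gcongr
          exact le_self_add
  · calc ∫⁻ x, ∫⁻ y, F x * (H y * g (x + t • (y - x)))
        ≤ ∫⁻ x, ∫⁻ y, F x * (b * g (t • y + (1 - t) • x)) := by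
          refine lintegral_mono fun x => lintegral_mono fun y => ?_
          dsimp only
          rw [show x + t • (y - x) = t • y + (1 - t) • x by module]
          gcongr
          exact hHb y
      _ = ∫⁻ x, F x * (b * ∫⁻ y, g (t • y + (1 - t) • x)) := by
          refine lintegral_congr fun y => ?_
          rw [lintegral_const_mul _ (by fun_prop), lintegral_const_mul _ (by fun_prop)]
      _ ≤ ∫⁻ x, F x * (b * (4 * ∫⁻ z, g z)) := by
          gcongr with x
          exact lintegral_comp_smul_add_le hg ht _
      _ = 4 * (b * ∫⁻ x, F x) * ∫⁻ z, g z := by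
          rw [lintegral_mul_const _ hF]
          ring
      _ ≤ _ := by
          gcongr
          exact le_add_self

theorem lintegral_lintegral_lintegral_segment_le {F H g : Plane → ℝ≥0∞} (hF : Measurable F)
    (hH : Measurable H) (hg : Measurable g) {a b : ℝ≥0∞} (hFa : ∀ x, F x ≤ a)
    (hHb : ∀ x, H x ≤ b) :
    ∫⁻ x, ∫⁻ y, F x * (H y * ∫⁻ t in Set.Ioc (0 : ℝ) 1, g (x + t • (y - x))) ≤
      4 * (a * (∫⁻ y, H y) + b * ∫⁻ x, F x) * ∫⁻ z, g z := by
  have h3 : Measurable fun p : (Plane × Plane) × ℝ =>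
      F p.1.1 * (H p.1.2 * g (p.1.1 + p.2 • (p.1.2 - p.1.1))) := by fun_prop
  calc ∫⁻ x, ∫⁻ y, F x * (H y * ∫⁻ t in Set.Ioc (0 : ℝ) 1, g (x + t • (y - x)))
      = ∫⁻ x, ∫⁻ y, ∫⁻ t in Set.Ioc (0 : ℝ) 1, F x * (H y * g (x + t • (y - x))) := by
        refine lintegral_congr fun x => lintegral_congr fun y => ?_
        rw [lintegral_const_mul _ (by fun_prop), lintegral_const_mul _ (by fun_prop)]
    _ = ∫⁻ x, ∫⁻ t in Set.Ioc (0 : ℝ) 1, ∫⁻ y, F x * (H y * g (x + t • (y - x))) := by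
        refine lintegral_congr fun x => lintegral_lintegral_swap (by fun_prop)
    _ = ∫⁻ t in Set.Ioc (0 : ℝ) 1, ∫⁻ x, ∫⁻ y, F x * (H y * g (x + t • (y - x))) := by
        refine lintegral_lintegral_swap (Measurable.aemeasurable ?_)
        exact Measurable.lintegral_prod_right
          (f := fun (p : Plane × ℝ) y => F p.1 * (H y * g (p.1 + p.2 • (y - p.1)))) (by fun_prop)
    _ ≤ ∫⁻ t in Set.Ioc (0 : ℝ) 1, 4 * (a * (∫⁻ y, H y) + b * ∫⁻ x, F x) * ∫⁻ z, g z :=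
        lintegral_mono fun t => lintegral_lintegral_segment_le hF hH hg hFa hHb t
    _ = _ := by simp

theorem exists_weight_le_one_add_norm_rpow {κ : ℝ} (hκ : 0 < κ) {h₀ : Plane → ℝ}
    (hcont : Continuous h₀) (heq : ∀ x : Plane, 1 ≤ ‖x‖ → h₀ x = ‖x‖ ^ (-κ)) :
    ∃ M, 0 < M ∧ ∀ x, h₀ x ≤ M * (1 + ‖x‖) ^ (-κ) := by
  obtain ⟨B, hB⟩ := (isCompact_closedBall (0 : Plane) 1).exists_bound_of_continuousOn
    hcont.continuousOn
  have hB1 : 1 ≤ max B 1 := le_max_right _ _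
  refine ⟨max B 1 * 2 ^ κ, by positivity, fun x => ?_⟩
  have hkey : ∀ r : ℝ, 0 < r → 1 + ‖x‖ ≤ 2 * r → r ^ (-κ) ≤ 2 ^ κ * (1 + ‖x‖) ^ (-κ) := by
    intro r hr hxr
    calc r ^ (-κ) = 2 ^ κ * (2 * r) ^ (-κ) := by
          rw [Real.mul_rpow (by norm_num) hr.le, ← mul_assoc,
            ← Real.rpow_add (by norm_num), add_neg_cancel, Real.rpow_zero, one_mul]
      _ ≤ 2 ^ κ * (1 + ‖x‖) ^ (-κ) := by
          gcongr 2 ^ κ * ?_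
          exact Real.rpow_le_rpow_of_nonpos (by positivity) hxr (by linarith)
  rcases le_total ‖x‖ 1 with hx | hx
  · have h1 : h₀ x ≤ B := (le_abs_self _).trans (hB x (by simpa using hx))
    have h2 := hkey 1 one_pos (by linarith)
    rw [Real.one_rpow] at h2
    calc h₀ x ≤ max B 1 * 1 := by rw [mul_one]; exact h1.trans (le_max_left _ _)
      _ ≤ max B 1 * (2 ^ κ * (1 + ‖x‖) ^ (-κ)) := by gcongr
      _ = _ := by ring
  · have h2 := hkey ‖x‖ (by linarith) (by linarith)
    rw [heq x hx]
    calc ‖x‖ ^ (-κ) ≤ 1 * (2 ^ κ * (1 + ‖x‖) ^ (-κ)) := by rwa [one_mul]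
      _ ≤ max B 1 * (2 ^ κ * (1 + ‖x‖) ^ (-κ)) := by gcongr
      _ = _ := by ring

theorem integrable_sq_mul_weight {κ : ℝ} (hκ : 4 < κ) {h₀ : Plane → ℝ}
    (hcont : Continuous h₀) (hpos : ∀ x, 0 < h₀ x)
    (heq : ∀ x : Plane, 1 ≤ ‖x‖ → h₀ x = ‖x‖ ^ (-κ)) :
    Integrable fun x => (1 + ‖x‖) ^ 2 * h₀ x := by
  obtain ⟨M, hM, hle⟩ := exists_weight_le_one_add_norm_rpow (by linarith) hcont heq
  have hint : Integrable fun x : Plane => M * (1 + ‖x‖) ^ (-(κ - 2)) := by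
    refine (integrable_one_add_norm ?_).const_mul M
    rw [finrank_euclideanSpace_fin]
    norm_num
    linarith
  refine hint.mono' (by fun_prop) (ae_of_all _ fun x => ?_)
  have h1 : (0 : ℝ) < 1 + ‖x‖ := by positivity
  rw [Real.norm_of_nonneg (mul_nonneg (by positivity) (hpos x).le)]
  calc (1 + ‖x‖) ^ 2 * h₀ x ≤ (1 + ‖x‖) ^ 2 * (M * (1 + ‖x‖) ^ (-κ)) := by
        gcongr
        exact hle x
    _ = M * ((1 + ‖x‖) ^ (2 : ℝ) * (1 + ‖x‖) ^ (-κ)) := by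
        rw [Real.rpow_two]
        ring
    _ = _ := by
        rw [← Real.rpow_add h1]
        congr 2
        ring

theorem exists_weight_bound {κ : ℝ} (hκ : 0 < κ) {h₀ : Plane → ℝ}
    (hcont : Continuous h₀) (heq : ∀ x : Plane, 1 ≤ ‖x‖ → h₀ x = ‖x‖ ^ (-κ)) :
    ∃ M, 0 < M ∧ ∀ x, h₀ x ≤ M := by
  obtain ⟨M, hM, hle⟩ := exists_weight_le_one_add_norm_rpow hκ hcont heq
  refine ⟨M, hM, fun x => (hle x).trans (mul_le_of_le_one_right hM.le ?_)⟩
  exact Real.rpow_le_one_of_one_le_of_nonpos (by linarith [norm_nonneg x]) (by linarith)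

theorem integrable_weight {h₀ : Plane → ℝ} (hcont : Continuous h₀) (hpos : ∀ x, 0 < h₀ x)
    (hint : Integrable fun x => (1 + ‖x‖) ^ 2 * h₀ x) : Integrable h₀ := by
  refine hint.mono' hcont.aestronglyMeasurable (ae_of_all _ fun x => ?_)
  rw [Real.norm_of_nonneg (hpos x).le]
  exact le_mul_of_one_le_left (hpos x).le (one_le_pow₀ (by linarith [norm_nonneg x]))

theorem isFiniteMeasure_wMeasure {h₀ : Plane → ℝ} (hint : Integrable h₀) :
    IsFiniteMeasure (wMeasure h₀) :=
  isFiniteMeasure_withDensity_ofReal hint.hasFiniteIntegral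

theorem wMeasure_real_univ_pos {h₀ : Plane → ℝ} (hcont : Continuous h₀) (hpos : ∀ x, 0 < h₀ x)
    (hint : Integrable h₀) : 0 < (wMeasure h₀).real Set.univ := by
  have := isFiniteMeasure_wMeasure hint
  rw [measureReal_def]
  refine ENNReal.toReal_pos ?_ (measure_ne_top _ _)
  rw [wMeasure, withDensity_apply _ MeasurableSet.univ, setLIntegral_univ]
  exact ((lintegral_pos_iff_support (by fun_prop)).2 (by
    rw [show Function.support (fun x => ENNReal.ofReal (h₀ x)) = Set.univ from
      Set.eq_univ_of_forall fun x => by simpa using hpos x]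
    exact Measure.measure_univ_pos.2 (NeZero.ne _))).ne'

theorem integrable_wMeasure_iff {h₀ : Plane → ℝ} (hcont : Continuous h₀) (hpos : ∀ x, 0 < h₀ x)
    {w : Plane → ℝ} : Integrable w (wMeasure h₀) ↔ Integrable fun x => h₀ x * w x := by
  rw [wMeasure, integrable_withDensity_iff_integrable_smul' (by fun_prop) (by simp)]
  simp [ENNReal.toReal_ofReal (hpos _).le]

theorem integral_wMeasure {h₀ : Plane → ℝ} (hcont : Continuous h₀) (hpos : ∀ x, 0 < h₀ x)
    (w : Plane → ℝ) : ∫ x, w x ∂(wMeasure h₀) = ∫ x, h₀ x * w x := by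
  rw [wMeasure, integral_withDensity_eq_integral_toReal_smul (by fun_prop) (by simp)]
  simp [ENNReal.toReal_ofReal (hpos _).le]

theorem ae_wMeasure_notMem_finite {h₀ : Plane → ℝ} {S : Set Plane} (hS : S.Finite) :
    ∀ᵐ x ∂(wMeasure h₀), x ∉ S :=
  (withDensity_absolutelyContinuous _ _).ae_le
    (measure_eq_zero_iff_ae_notMem.1 (hS.measure_zero volume))

/-- Jensen's inequality for the weighted measure: the exponential integral of a function with
vanishing weighted mean is bounded below, uniformly in the function. -/
theorem exists_pos_mul_exp_le_integral {h₀ : Plane → ℝ} (hcont : Continuous h₀)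
    (hpos : ∀ x, 0 < h₀ x) (hint : Integrable h₀) {M : ℝ} (hM : 0 < M) (hle : ∀ x, h₀ x ≤ M)
    {W : Plane → ℝ} (hWnn : ∀ x, 0 ≤ W x)
    {S : Set Plane} (hS : S.Finite) (hWpos : ∀ x ∉ S, 0 < W x)
    (hlog : Integrable (fun x => Real.log (W x)) (wMeasure h₀)) :
    ∃ c : ℝ, 0 < c ∧ ∀ (w : Plane → ℝ) (b : ℝ), Integrable w (wMeasure h₀) →
      ∫ x, w x ∂(wMeasure h₀) = 0 → Integrable (fun x => W x * Real.exp (b + w x)) →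
      c * Real.exp b ≤ ∫ x, W x * Real.exp (b + w x) := by
  have hfin := isFiniteMeasure_wMeasure hint
  have hmpos := wMeasure_real_univ_pos hcont hpos hint
  set m := (wMeasure h₀).real Set.univ
  set a := (∫ x, Real.log (W x) ∂(wMeasure h₀)) / m with ha
  refine ⟨M⁻¹ * (m * Real.exp a), by positivity, fun w b hw hw0 hWint => ?_⟩
  have hWint' : Integrable (fun x => h₀ x * (W x * Real.exp (b + w x))) :=
    hWint.bdd_mul (c := M) hcont.aestronglyMeasurable
      (ae_of_all _ fun x => by rw [Real.norm_of_nonneg (hpos x).le]; exact hle x)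
  have hlower : m * Real.exp (b + a) ≤ ∫ x, W x * Real.exp (b + w x) ∂(wMeasure h₀) := by
    have hsum : Integrable (fun x => Real.log (W x) + w x) (wMeasure h₀) := hlog.add hw
    have hlin : Integrable (fun x => Real.log (W x) + w x + (1 - a)) (wMeasure h₀) :=
      hsum.add (integrable_const _)
    calc m * Real.exp (b + a)
        = ∫ x, Real.exp (b + a) * (Real.log (W x) + w x + (1 - a)) ∂(wMeasure h₀) := by
          rw [integral_const_mul, integral_add hsum (integrable_const _),
            integral_add hlog hw, hw0, integral_const, smul_eq_mul,
            (div_eq_iff hmpos.ne').1 ha.symm]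
          ring
      _ ≤ _ := by
          refine integral_mono_ae (hlin.const_mul _)
            ((integrable_wMeasure_iff hcont hpos).2 hWint') ?_
          filter_upwards [ae_wMeasure_notMem_finite hS] with x hx
          have hWx := hWpos x hx
          have hexp : W x * Real.exp (b + w x) =
              Real.exp (b + a) * Real.exp (Real.log (W x) + w x - a) := by
            nth_rewrite 1 [← Real.exp_log hWx]
            rw [← Real.exp_add, ← Real.exp_add]
            ring_nf
          rw [hexp]
          gcongr
          linarith [Real.add_one_le_exp (Real.log (W x) + w x - a)]
  have hupper : ∫ x, W x * Real.exp (b + w x) ∂(wMeasure h₀) ≤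
      M * ∫ x, W x * Real.exp (b + w x) := by
    rw [integral_wMeasure hcont hpos, ← integral_const_mul]
    refine integral_mono hWint' (hWint.const_mul M) fun x => ?_
    exact mul_le_mul_of_nonneg_right (hle x) (mul_nonneg (hWnn x) (Real.exp_pos _).le)
  calc M⁻¹ * (m * Real.exp a) * Real.exp b = M⁻¹ * (m * Real.exp (b + a)) := by
        rw [Real.exp_add]
        ring
    _ ≤ M⁻¹ * (M * ∫ x, W x * Real.exp (b + w x)) := by
        exact mul_le_mul_of_nonneg_left (hlower.trans hupper) (inv_nonneg.2 hM.le)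
    _ = _ := by field_simp

theorem norm_gradient_eq_norm_fderiv (u : Plane → ℝ) (x : Plane) :
    ‖gradient u x‖ = ‖fderiv ℝ u x‖ := by
  simp [gradient]

theorem MemH.integrable {h₀ : Plane → ℝ} (hint : Integrable h₀) {u : Plane → ℝ}
    (hu : MemH h₀ u) : Integrable u (wMeasure h₀) := by
  have := isFiniteMeasure_wMeasure hint
  have hmeas : AEStronglyMeasurable u (wMeasure h₀) := hu.1.continuous.aestronglyMeasurable
  exact ((memLp_two_iff_integrable_sq hmeas).2 hu.2.2).integrable one_le_two

/-- A weighted Poincaré inequality, tested against a compactly supported function. -/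
theorem exists_abs_integral_mul_le {h₀ : Plane → ℝ} (hcont : Continuous h₀)
    (hpos : ∀ x, 0 < h₀ x) (hsq : Integrable fun x => (1 + ‖x‖) ^ 2 * h₀ x)
    {M : ℝ} (hle : ∀ x, h₀ x ≤ M) {f : Plane → ℝ} (hf : Continuous f)
    (hfs : HasCompactSupport f) {ε : ℝ} (hε : 0 < ε) :
    ∃ C : ℝ, ∀ u : Plane → ℝ, MemHt h₀ u →
      |∫ x, f x * u x| ≤ ε * (∫ x, ‖gradient u x‖ ^ 2) + C := by
  have hint := integrable_weight hcont hpos hsq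
  have hfin := isFiniteMeasure_wMeasure hint
  have hmpos := wMeasure_real_univ_pos hcont hpos hint
  set m := (wMeasure h₀).real Set.univ
  obtain ⟨A, hA⟩ := hfs.exists_bound_of_continuous hf
  set F : Plane → ℝ≥0∞ := fun x => ‖f x‖ₑ with hFdef
  set H : Plane → ℝ≥0∞ := fun x => ENNReal.ofReal (h₀ x) with hHdef
  have hF : Measurable F := by fun_prop
  have hH : Measurable H := by fun_prop
  have hFA : ∀ x, F x ≤ ENNReal.ofReal A := fun x => by
    simp only [hFdef, ← ofReal_norm]
    exact ENNReal.ofReal_le_ofReal (hA x)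
  have hHM : ∀ x, H x ≤ ENNReal.ofReal M := fun x => ENNReal.ofReal_le_ofReal (hle x)
  set K : ℝ≥0∞ := 4 * (ENNReal.ofReal A * (∫⁻ y, H y) + ENNReal.ofReal M * ∫⁻ x, F x) with hK
  set D : ℝ≥0∞ := ∫⁻ x, ∫⁻ y, F x * (H y * ‖y - x‖ₑ ^ 2) with hD
  have hKtop : K ≠ ∞ := by
    have h1 : ∫⁻ y, H y ≠ ∞ := hint.lintegral_lt_top.ne
    have h2 : ∫⁻ x, F x ≠ ∞ := (hf.integrable_of_hasCompactSupport hfs).hasFiniteIntegral.ne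
    finiteness
  have hDtop : D ≠ ∞ := by
    have h1 : ∫⁻ y, ‖(1 + ‖y‖) ^ 2 * h₀ y‖ₑ ≠ ∞ := hsq.hasFiniteIntegral.ne
    have h2 : ∫⁻ x, ‖(1 + ‖x‖) ^ 2 * f x‖ₑ ≠ ∞ := by
      have hc : Integrable fun x => (1 + ‖x‖) ^ 2 * f x :=
        (by fun_prop : Continuous fun x => (1 + ‖x‖) ^ 2 * f x).integrable_of_hasCompactSupport
          hfs.mul_left
      exact hc.hasFiniteIntegral.ne
    refine ne_top_of_le_ne_top (ENNReal.mul_ne_top h2 h1) ?_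
    rw [← lintegral_mul_const _ (by fun_prop)]
    refine lintegral_mono fun x => ?_
    rw [← lintegral_const_mul _ (by fun_prop)]
    refine lintegral_mono fun y => ?_
    simp only [hFdef, hHdef, ← ofReal_norm]
    rw [← ENNReal.ofReal_pow (norm_nonneg _), ← ENNReal.ofReal_mul (hpos y).le,
      ← ENNReal.ofReal_mul (norm_nonneg _), ← ENNReal.ofReal_mul (norm_nonneg _)]
    apply ENNReal.ofReal_le_ofReal
    have hxy : ‖y - x‖ ≤ (1 + ‖x‖) * (1 + ‖y‖) := by
      nlinarith [norm_sub_le y x, norm_nonneg x, norm_nonneg y,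
        mul_nonneg (norm_nonneg x) (norm_nonneg y)]
    rw [norm_mul, norm_mul, Real.norm_of_nonneg (hpos y).le, norm_pow, norm_pow,
      Real.norm_of_nonneg (by positivity : 0 ≤ 1 + ‖x‖),
      Real.norm_of_nonneg (by positivity : 0 ≤ 1 + ‖y‖)]
    calc ‖f x‖ * (h₀ y * ‖y - x‖ ^ 2) ≤ ‖f x‖ * (h₀ y * ((1 + ‖x‖) * (1 + ‖y‖)) ^ 2) := by
          have := (hpos y).le
          gcongr
      _ = _ := by ring
  set η : ℝ := ε * m / (K.toReal + 1) with hη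
  have hηpos : 0 < η := by positivity
  refine ⟨(ENNReal.ofReal η⁻¹ * D).toReal / m, fun u hu => ?_⟩
  have huint := hu.1.integrable hint
  set g : Plane → ℝ≥0∞ := fun z => ‖fderiv ℝ u z‖ₑ ^ 2 with hg
  have hgm : Measurable g := (measurable_fderiv ℝ u).enorm.pow_const 2
  have hucont := hu.1.1.continuous
  have hmean : ∀ x, ∫ y, (u x - u y) ∂(wMeasure h₀) = m * u x := fun x => by
    rw [integral_sub (integrable_const _) huint, hu.2, integral_const, sub_zero, smul_eq_mul]
  have hG : ∫⁻ z, g z = ENNReal.ofReal (∫ x, ‖gradient u x‖ ^ 2) := by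
    rw [ofReal_integral_eq_lintegral_ofReal hu.1.2.1 (ae_of_all _ fun x => by positivity)]
    refine lintegral_congr fun x => ?_
    rw [hg, norm_gradient_eq_norm_fderiv, ENNReal.ofReal_pow (norm_nonneg _), ofReal_norm]
  have hE : ‖∫ x, f x * (m * u x)‖ₑ ≤
      ENNReal.ofReal η * (K * ∫⁻ z, g z) + ENNReal.ofReal η⁻¹ * D := by
    calc ‖∫ x, f x * (m * u x)‖ₑ ≤ ∫⁻ x, ‖f x * (m * u x)‖ₑ :=
          enorm_integral_le_lintegral_enorm _
      _ ≤ ∫⁻ x, ∫⁻ y, F x * (H y * ‖u y - u x‖ₑ) := by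
          refine lintegral_mono fun x => ?_
          rw [enorm_mul, ← hmean x, lintegral_const_mul _ (by fun_prop)]
          gcongr
          refine (enorm_integral_le_lintegral_enorm _).trans_eq ?_
          rw [wMeasure, lintegral_withDensity_eq_lintegral_mul _ hH (by fun_prop)]
          simp only [Pi.mul_apply, enorm_sub_rev (u x)]
      _ ≤ ∫⁻ x, ∫⁻ y, (ENNReal.ofReal η *
            (F x * (H y * ∫⁻ t in Set.Ioc (0 : ℝ) 1, g (x + t • (y - x))))
            + ENNReal.ofReal η⁻¹ * (F x * (H y * ‖y - x‖ₑ ^ 2))) := by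
          refine lintegral_mono fun x => lintegral_mono fun y => ?_
          calc F x * (H y * ‖u y - u x‖ₑ)
              ≤ F x * (H y * (ENNReal.ofReal η *
                  (∫⁻ t in Set.Ioc (0 : ℝ) 1, g (x + t • (y - x)))
                  + ENNReal.ofReal η⁻¹ * ‖y - x‖ₑ ^ 2)) := by
                gcongr
                exact enorm_sub_le_lintegral_sq hu.1.1 x y hηpos
            _ = _ := by ring
      _ = ENNReal.ofReal η *
            (∫⁻ x, ∫⁻ y, F x * (H y * ∫⁻ t in Set.Ioc (0 : ℝ) 1, g (x + t • (y - x))))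
            + ENNReal.ofReal η⁻¹ * D := by
          have hm1 : Measurable fun p : Plane × Plane =>
              F p.1 * (H p.2 * ‖p.2 - p.1‖ₑ ^ 2) := by fun_prop
          rw [hD, ← lintegral_const_mul' _ _ ENNReal.ofReal_ne_top,
            ← lintegral_const_mul' _ _ ENNReal.ofReal_ne_top, ← lintegral_add_right]
          · refine lintegral_congr fun x => ?_
            rw [lintegral_add_right _ (by fun_prop), lintegral_const_mul' _ _ ENNReal.ofReal_ne_top,
              lintegral_const_mul' _ _ ENNReal.ofReal_ne_top]
          · exact (hm1.lintegral_prod_right').const_mul _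
      _ ≤ _ := by
          gcongr
          exact lintegral_lintegral_lintegral_segment_le hF hH hgm hFA hHM
  have hreal : m * |∫ x, f x * u x| ≤
      η * (K.toReal * ∫ x, ‖gradient u x‖ ^ 2) + (ENNReal.ofReal η⁻¹ * D).toReal := by
    have hG0 : 0 ≤ ∫ x, ‖gradient u x‖ ^ 2 := integral_nonneg fun x => by positivity
    have hne1 : ENNReal.ofReal η * (K * ∫⁻ z, g z) ≠ ∞ :=
      ENNReal.mul_ne_top ENNReal.ofReal_ne_top
        (ENNReal.mul_ne_top hKtop (hG ▸ ENNReal.ofReal_ne_top))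
    have hne2 : ENNReal.ofReal η⁻¹ * D ≠ ∞ := ENNReal.mul_ne_top ENNReal.ofReal_ne_top hDtop
    have h1 := ENNReal.toReal_mono (ENNReal.add_ne_top.2 ⟨hne1, hne2⟩) hE
    rw [ENNReal.toReal_add hne1 hne2, ENNReal.toReal_mul,
      ENNReal.toReal_ofReal hηpos.le, ENNReal.toReal_mul, hG, ENNReal.toReal_ofReal hG0,
      toReal_enorm] at h1
    simp only [mul_left_comm _ m, integral_const_mul, norm_mul, Real.norm_eq_abs,
      abs_of_pos hmpos] at h1
    exact h1
  have hηK : η * K.toReal ≤ ε * m := by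
    rw [hη, div_mul_eq_mul_div, div_le_iff₀ (by positivity)]
    gcongr
    linarith
  have hG0 : 0 ≤ ∫ x, ‖gradient u x‖ ^ 2 := integral_nonneg fun x => by positivity
  rw [← mul_le_mul_iff_right₀ hmpos]
  calc m * |∫ x, f x * u x| ≤ _ := hreal
    _ ≤ ε * m * (∫ x, ‖gradient u x‖ ^ 2) + (ENNReal.ofReal η⁻¹ * D).toReal := by
        rw [← mul_assoc]
        gcongr
    _ = _ := by field_simp

theorem le_log_div_of_mul_exp_le {c b A : ℝ} (hc : 0 < c) (h : c * Real.exp b ≤ A) :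
    b ≤ Real.log (A / c) := by
  have hle : Real.exp b ≤ A / c := by
    rw [le_div_iff₀ hc]
    linarith
  exact (Real.le_log_iff_exp_le ((Real.exp_pos b).trans_le hle)).2 hle

theorem gradient_eq_of_eq_const_add {u v : Plane → ℝ} {c : ℝ} (huv : ∀ x, u x = c + v x) :
    gradient u = gradient v := by
  ext1 x
  rw [show u = fun x => c + v x from funext huv, gradient, gradient, fderiv_const_add]

theorem integral_mul_const_add {f v : Plane → ℝ} (hf : Continuous f)
    (hfs : HasCompactSupport f) (hv : Continuous v) (c : ℝ) :
    ∫ x, f x * (c + v x) = c * (∫ x, f x) + ∫ x, f x * v x := by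
  have hfv : Integrable fun x => f x * v x :=
    (hf.mul hv).integrable_of_hasCompactSupport hfs.mul_right
  rw [← integral_const_mul,
    ← integral_add ((hf.integrable_of_hasCompactSupport hfs).const_mul c) hfv]
  exact integral_congr_ae (ae_of_all _ fun x => by ring)

theorem Ifun_eq {h₀ : Plane → ℝ} {p q : ℝ} {f h ξ ζ : Plane → ℝ} (hf : Continuous f)
    (hfs : HasCompactSupport f) (hh : Continuous h) (hhs : HasCompactSupport h)
    (hξ : MemH h₀ ξ) (hζ : MemH h₀ ζ) :
    Ifun p q f h ξ ζ = 1 / 2 * (∫ x, ‖gradient ξ x‖ ^ 2)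
      + Kdet p q / (2 * k12 p q ^ 2) * (∫ x, ‖gradient ζ x‖ ^ 2)
      + (∫ x, f x * ξ x) + Kdet p q / k12 p q ^ 2 * ∫ x, h x * ζ x := by
  have h1 : Integrable fun x => f x * ξ x :=
    (hf.mul hξ.1.continuous).integrable_of_hasCompactSupport hfs.mul_right
  have h2 : Integrable fun x => h x * ζ x :=
    (hh.mul hζ.1.continuous).integrable_of_hasCompactSupport hhs.mul_right
  have h3 := hξ.2.1.const_mul (1 / 2)
  have h4 := hζ.2.1.const_mul (Kdet p q / (2 * k12 p q ^ 2))
  have h5 : Integrable fun x => 1 / 2 * ‖gradient ξ x‖ ^ 2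
      + Kdet p q / (2 * k12 p q ^ 2) * ‖gradient ζ x‖ ^ 2 := h3.add h4
  have h6 : Integrable fun x => 1 / 2 * ‖gradient ξ x‖ ^ 2
      + Kdet p q / (2 * k12 p q ^ 2) * ‖gradient ζ x‖ ^ 2 + f x * ξ x := h5.add h1
  simp only [Ifun, mul_assoc (Kdet p q / k12 p q ^ 2)]
  rw [integral_add h6 (h2.const_mul _), integral_add h5 h1,
    integral_add h3 h4, integral_const_mul, integral_const_mul, integral_const_mul]

/-- Coercivity and lower bound of I on 𝒜 when 0 < k₁₂ < 1 (i.e. p > q > 0). -/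
theorem coercivity_k12_pos
    (κ : ℝ) (hκ : 4 < κ) (h₀ : Plane → ℝ)
    (h₀smooth : ContDiff ℝ (⊤ : ℕ∞) h₀) (h₀pos : ∀ x, 0 < h₀ x)
    (h₀eq : ∀ x : Plane, 1 ≤ ‖x‖ → h₀ x = ‖x‖ ^ (-κ))
    (p q : ℝ) (hp : 0 < p) (hq : 0 < q) (hpq : p ≠ q)
    (α β : ℝ)
    (f h : Plane → ℝ)
    (hfcont : Continuous f) (hfsupp : HasCompactSupport f)
    (hhcont : Continuous h) (hhsupp : HasCompactSupport h)
    (hfint : ∫ x, f x = -(2 * π * α)) (hhint : ∫ x, h x = 2 * π * β)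
    (U V : Plane → ℝ)
    (hUcont : Continuous U) (hVcont : Continuous V)
    (hUnn : ∀ x, 0 ≤ U x) (hVnn : ∀ x, 0 ≤ V x)
    (SU SV : Set Plane) (hSU : SU.Finite) (hSV : SV.Finite)
    (hUpos : ∀ x ∉ SU, 0 < U x) (hVpos : ∀ x ∉ SV, 0 < V x)
    (hlogU : Integrable (fun x => Real.log (U x)) (wMeasure h₀))
    (hlogV : Integrable (fun x => Real.log (V x)) (wMeasure h₀))
    (CUV : ℝ) (hCUV : 0 < CUV)
    (hUbd : ∀ x, U x ≤ CUV * Real.exp (-‖x‖))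
    (hVbd : ∀ x, V x ≤ CUV * Real.exp (-‖x‖))
    (hqp : q < p) (hα : 0 < α)
    (hβ : β > α * k12 p q ^ 2 / Kdet p q) :
    ∃ δ C : ℝ, 0 < δ ∧
      ∀ (ξ ζ : Plane → ℝ) (ξb ζb : ℝ) (ξ' ζ' : Plane → ℝ),
        Admissible h₀ p q α β U V ξ ζ →
        MemHt h₀ ξ' → MemHt h₀ ζ' →
        (∀ x, ξ x = ξb + ξ' x) → (∀ x, ζ x = ζb + ζ' x) →
        δ * ((∫ x, ‖gradient ξ' x‖ ^ 2)
            + Kdet p q / k12 p q ^ 2 * ∫ x, ‖gradient ζ' x‖ ^ 2) + C ≤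
          Ifun p q f h ξ ζ := by
  have hcont := h₀smooth.continuous
  have hsq := integrable_sq_mul_weight hκ hcont h₀pos h₀eq
  have hint := integrable_weight hcont h₀pos hsq
  obtain ⟨M, hM, hle⟩ := exists_weight_bound (by linarith) hcont h₀eq
  have hk : 0 < k12 p q := div_pos (by linarith) hp
  have hL : 0 < k11 p q := div_pos (by linarith) hp
  have hK : 0 < Kdet p q := div_pos (by linarith) hp
  set k := k12 p q
  set L := k11 p q
  set K := Kdet p q
  set σ := K / k ^ 2 with hσ
  have hσpos : 0 < σ := by positivity
  have hσβ : 0 < σ * β - α := by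
    have h1 : α < β * K / k ^ 2 := by
      rw [lt_div_iff₀ (by positivity)]
      exact (div_lt_iff₀ hK).1 hβ
    rw [hσ, div_mul_eq_mul_div, mul_comm K β]
    linarith
  set a := L / (2 * k) with ha
  have hapos : 0 < a := by positivity
  obtain ⟨C₁, hC₁⟩ := exists_abs_integral_mul_le hcont h₀pos hsq hle hfcont hfsupp
    (by norm_num : (0 : ℝ) < 1 / 4)
  obtain ⟨C₂, hC₂⟩ := exists_abs_integral_mul_le hcont h₀pos hsq hle hhcont hhsupp
    (by norm_num : (0 : ℝ) < 1 / 4)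
  obtain ⟨cU, hcU, hU⟩ := exists_pos_mul_exp_le_integral hcont h₀pos hint hM hle hUnn hSU hUpos
    hlogU
  obtain ⟨cV, hcV, hV⟩ := exists_pos_mul_exp_le_integral hcont h₀pos hint hM hle hVnn hSV hVpos
    hlogV
  set A := 2 * π * α / (2 * K / L) with hA
  set B := (2 * π * β - 2 * k ^ 2 / L * A) / (2 * k) with hB
  refine ⟨1 / 4, -C₁ - σ * C₂ - 2 * π * α * (2 * Real.log (A / cV))
    - 2 * π * (σ * β - α) * (Real.log (B / cU) / a), by norm_num, ?_⟩
  intro ξ ζ ξb ζb ξ' ζ' hadm hξ' hζ' hξ hζ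
  obtain ⟨hξH, hζH, hVint, hUint, hVeq, hUeq⟩ := hadm
  have hAeq : ∫ x, V x * Real.exp ((ξ x - ζ x) / 2) = A := by
    rw [hA, eq_div_iff (by positivity)]
    linarith
  have hBeq : ∫ x, U x * Real.exp (-a * ζ x) = B := by
    rw [hB, eq_div_iff (by positivity), ← hAeq]
    linarith
  have hξi := hξ'.1.integrable hint
  have hζi := hζ'.1.integrable hint
  have hdiff : ξb - ζb ≤ 2 * Real.log (A / cV) := by
    have hw : ∀ x, (ξ x - ζ x) / 2 = (ξb - ζb) / 2 + (ξ' x - ζ' x) / 2 := fun x => by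
      rw [hξ, hζ]
      ring
    simp only [hw] at hVint hAeq
    have h1 := hV _ _ ((hξi.sub hζi).div_const 2)
      (by simp [integral_div, integral_sub hξi hζi, hξ'.2, hζ'.2]) hVint
    have h2 := le_log_div_of_mul_exp_le hcV (h1.trans_eq hAeq)
    linarith
  have hζb : -(Real.log (B / cU) / a) ≤ ζb := by
    have hw : ∀ x, -a * ζ x = -a * ζb + -a * ζ' x := fun x => by
      rw [hζ]
      ring
    change Integrable (fun x => U x * Real.exp (-a * ζ x)) at hUint
    simp only [hw] at hUint hBeq
    have h1 := hU _ _ (hζi.const_mul (-a)) (by rw [integral_const_mul, hζ'.2, mul_zero]) hUint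
    have h2 := le_log_div_of_mul_exp_le hcU (h1.trans_eq hBeq)
    rw [neg_le, le_div_iff₀ hapos]
    linarith
  have hfξ : ∫ x, f x * ξ x = ξb * -(2 * π * α) + ∫ x, f x * ξ' x := by
    simp only [hξ]
    rw [integral_mul_const_add hfcont hfsupp hξ'.1.1.continuous, hfint]
  have hhζ : ∫ x, h x * ζ x = ζb * (2 * π * β) + ∫ x, h x * ζ' x := by
    simp only [hζ]
    rw [integral_mul_const_add hhcont hhsupp hζ'.1.1.continuous, hhint]
  rw [Ifun_eq hfcont hfsupp hhcont hhsupp hξH hζH, hfξ, hhζ, gradient_eq_of_eq_const_add hξ,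
    gradient_eq_of_eq_const_add hζ, show Kdet p q / (2 * k12 p q ^ 2) = σ / 2 by
      rw [hσ, div_div, mul_comm]]
  have e1 := (abs_le.1 (hC₁ ξ' hξ')).1
  have e2 := mul_le_mul_of_nonneg_left (abs_le.1 (hC₂ ζ' hζ')).1 hσpos.le
  have e3 := mul_le_mul_of_nonneg_left hdiff (by positivity : 0 ≤ 2 * π * α)
  have e4 := mul_le_mul_of_nonneg_left hζb (by positivity : 0 ≤ 2 * π * (σ * β - α))
  have hG1 : 0 ≤ ∫ x, ‖gradient ξ' x‖ ^ 2 := integral_nonneg fun x => by positivity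
  linarith
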